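/- Let p_1,...,p_n ∈ P^2 be distinct K-points and let I = ∩_i I(p_i) ⊆ K[x_0,x_1,x_2]. Set α_m = α(I^(m)) and β_m = β(I^(m)), and write α_1 = α(I). Then for every m ≥ 1, α_m/m ≥ ((α_1+1)/2)·(m·α_1/β_m). -/

import Mathlib

open MvPolynomial
open scoped LinearAlgebra.Projectivization

noncomputable section

/-- The homogeneous vanishing ideal of a point of projective `N`-space:
the ideal generated by all forms vanishing at the point. -/
def pointIdeal {K : Type*} [Field K] {N : ℕ} (q : ℙ K (Fin (N + 1) → K)) :
    Ideal (MvPolynomial (Fin (N + 1)) K) :=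
  Ideal.span {f | (∃ d : ℕ, f.IsHomogeneous d) ∧ MvPolynomial.eval q.rep f = 0}

/-- `α(J)`: the least degree of a nonzero form in `J`. -/
def alphaDeg {σ K : Type*} [CommSemiring K] (J : Ideal (MvPolynomial σ K)) : ℕ :=
  sInf {d : ℕ | ∃ f ∈ J, f ≠ 0 ∧ MvPolynomial.IsHomogeneous f d}

/-- `β(J)`: the least degree `d` such that the degree-`d` graded piece of `J`
contains a regular sequence of length two. -/
def betaDeg {σ K : Type*} [CommRing K] (J : Ideal (MvPolynomial σ K)) : ℕ :=
  sInf {d : ℕ | ∃ f g : MvPolynomial σ K, f ∈ J ∧ g ∈ J ∧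
    f.IsHomogeneous d ∧ g.IsHomogeneous d ∧
    RingTheory.Sequence.IsRegular (MvPolynomial σ K) [f, g]}

section Monomials

variable {σ K : Type*} [Field K]

/-- The coefficients of a polynomial at a finite set of monomials. -/
def coeffsOn (s : Finset (σ →₀ ℕ)) : MvPolynomial σ K →ₗ[K] (s → K) :=
  LinearMap.pi fun x => lcoeff K x.1

@[simp]
lemma coeffsOn_apply (s : Finset (σ →₀ ℕ)) (q : MvPolynomial σ K) (x : s) :
    coeffsOn s q x = q.coeff x.1 := rfl

lemma exists_coeffsOn_eq (s : Finset (σ →₀ ℕ)) (z : s → K) :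
    ∃ q : MvPolynomial σ K, q.support ⊆ s ∧ coeffsOn s q = z := by
  classical
  have h (y : σ →₀ ℕ) : (∑ x : s, monomial x.1 (z x)).coeff y =
      if hy : y ∈ s then z ⟨y, hy⟩ else 0 := by
    simp only [coeff_sum, coeff_monomial]
    split_ifs with hy
    · rw [Finset.sum_eq_single ⟨y, hy⟩] <;> simp +contextual [Subtype.ext_iff]
    · refine Finset.sum_eq_zero fun x _ => if_neg ?_
      rintro rfl
      exact hy x.2
  refine ⟨∑ x : s, monomial x.1 (z x), fun y hy => ?_, ?_⟩
  · by_contra hs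
    rw [mem_support_iff, h, dif_neg hs] at hy
    exact hy rfl
  · ext x
    rw [coeffsOn_apply, h, dif_pos x.2]

lemma isHomogeneous_of_mul_left {f q : MvPolynomial σ K} {a c : ℕ} (hf : f.IsHomogeneous a)
    (h0 : f ≠ 0) (h : (f * q).IsHomogeneous (a + c)) : q.IsHomogeneous c := by
  let _ : GradedAlgebra (homogeneousSubmodule σ K) := gradedAlgebra
  have h1 := DirectSum.coe_decompose_mul_add_of_left_mem (homogeneousSubmodule σ K) (i := a)
    (j := c) (b := q) hf
  rw [DirectSum.decompose_of_mem_same _ h] at h1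
  rw [mul_left_cancel₀ h0 h1]
  exact (DirectSum.decompose (homogeneousSubmodule σ K) q c).2

variable (σ) [Fintype σ] [DecidableEq σ]

/-- The exponents of total degree `d`. -/
def expDeg (d : ℕ) : Finset (σ →₀ ℕ) :=
  Finset.univ.finsuppAntidiag d

/-- The exponents of total degree less than `k`. -/
def expLT (k : ℕ) : Finset (σ →₀ ℕ) :=
  (Finset.range k).biUnion (expDeg σ)

variable {σ}

@[simp]
lemma mem_expDeg {d : ℕ} {x : σ →₀ ℕ} : x ∈ expDeg σ d ↔ x.degree = d := by
  simp [expDeg, Finsupp.degree_eq_sum]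

@[simp]
lemma mem_expLT {k : ℕ} {x : σ →₀ ℕ} : x ∈ expLT σ k ↔ x.degree < k := by
  simp [expLT]

lemma card_expDeg_three (d : ℕ) : ((expDeg (Fin 3) d).card : ℚ) = (d + 1) * (d + 2) / 2 := by
  rw [expDeg, Finset.card_finsuppAntidiag_nat_eq_choose]
  rw [show (Finset.univ : Finset (Fin 3)).card + d - 1 = 2 + d by
    simp only [Finset.card_univ, Fintype.card_fin]; omega,
    ← Nat.choose_symm_add, Nat.cast_choose_two]
  push_cast
  ring

lemma card_expLT_two (k : ℕ) : ((expLT (Fin 2) k).card : ℚ) = k * (k + 1) / 2 := by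
  rw [expLT, Finset.card_biUnion]
  · have h (j : ℕ) : (expDeg (Fin 2) j).card = j + 1 := by
      rw [expDeg, Finset.card_finsuppAntidiag_nat_eq_choose]
      rw [show (Finset.univ : Finset (Fin 2)).card + j - 1 = 1 + j by
        simp only [Finset.card_univ, Fintype.card_fin]; omega,
        ← Nat.choose_symm_add]
      simp [add_comm]
    simp only [h]
    induction k with
    | zero => simp
    | succ k ih =>
      rw [Finset.sum_range_succ]
      push_cast at ih ⊢
      rw [ih]
      ring
  · intro i _ j _ hij
    refine Finset.disjoint_left.2 fun x hx hy => ?_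
    simp only [mem_expDeg] at hx hy
    exact hij (hx.symm.trans hy)

lemma coeffsOn_expLT_eq_zero_iff {k : ℕ} {q : MvPolynomial σ K} :
    coeffsOn (expLT σ k) q = 0 ↔ q ∈ idealOfVars σ K ^ k := by
  rw [mem_pow_idealOfVars_iff', funext_iff]
  simp

/-- A form is determined by its coefficients in its own degree. -/
def homogeneousEquiv (d : ℕ) : homogeneousSubmodule σ K d ≃ₗ[K] (expDeg σ d → K) :=
  LinearEquiv.ofBijective ((coeffsOn (expDeg σ d)).domRestrict _) <| by
    constructor
    · rw [← LinearMap.ker_eq_bot, LinearMap.ker_eq_bot']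
      rintro ⟨q, hq⟩ h
      ext x
      by_cases hx : x.degree = d
      · simpa using congrFun h ⟨x, mem_expDeg.2 hx⟩
      · simpa using ((mem_homogeneousSubmodule _ _).1 hq).coeff_eq_zero hx
    · intro z
      obtain ⟨q, hq, hz⟩ := exists_coeffsOn_eq _ z
      refine ⟨⟨q, fun x hx => ?_⟩, hz⟩
      rw [Pi.one_def, ← Finsupp.degree_eq_weight_one]
      exact mem_expDeg.1 (hq (mem_support_iff.2 hx))

instance (d : ℕ) : FiniteDimensional K (homogeneousSubmodule σ K d) :=
  (homogeneousEquiv d).symm.finiteDimensional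

lemma finrank_homogeneousSubmodule (d : ℕ) :
    Module.finrank K (homogeneousSubmodule σ K d) = (expDeg σ d).card := by
  rw [(homogeneousEquiv d).finrank_eq]
  simp

end Monomials

section PolynomialFamilies

variable {σ K : Type*} [Field K]

/-- Polynomials in a parameter, of degree less than `e`, whose coefficients are forms of
degree `d`. -/
def formsDegreeLT (σ K : Type*) [Field K] (e d : ℕ) :
    Submodule K (Polynomial (MvPolynomial σ K)) where
  carrier := {p | p.degree < e ∧ ∀ j, (p.coeff j).IsHomogeneous d}
  zero_mem' := ⟨by simp, fun j => by simpa using isHomogeneous_zero _ _ d⟩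
  add_mem' := fun {p q} hp hq =>
    ⟨(Polynomial.degree_add_le p q).trans_lt (max_lt hp.1 hq.1),
      fun j => by simpa using (hp.2 j).add (hq.2 j)⟩
  smul_mem' := fun r p hp =>
    ⟨(Polynomial.degree_smul_le r p).trans_lt hp.1,
      fun j => by simpa using (homogeneousSubmodule σ K d).smul_mem r (hp.2 j)⟩

lemma mem_formsDegreeLT {e d : ℕ} {p : Polynomial (MvPolynomial σ K)} :
    p ∈ formsDegreeLT σ K e d ↔ p.degree < e ∧ ∀ j, (p.coeff j).IsHomogeneous d := Iff.rfl

/-- Apply a linear map to the first `e` coefficients of a polynomial. -/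
def mapCoeffs {V : Type*} [AddCommGroup V] [Module K V] (e : ℕ) (τ : MvPolynomial σ K →ₗ[K] V) :
    Polynomial (MvPolynomial σ K) →ₗ[K] (Fin e → V) :=
  LinearMap.pi fun j => τ ∘ₗ (Polynomial.lcoeff (MvPolynomial σ K) j).restrictScalars K

@[simp]
lemma mapCoeffs_apply {V : Type*} [AddCommGroup V] [Module K V] {e : ℕ}
    (τ : MvPolynomial σ K →ₗ[K] V) (p : Polynomial (MvPolynomial σ K)) (j : Fin e) :
    mapCoeffs e τ p j = τ (p.coeff j) := rfl

lemma exists_coeff_eq {e d : ℕ} {z : Fin e → MvPolynomial σ K}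
    (hz : ∀ j, (z j).IsHomogeneous d) :
    ∃ p ∈ formsDegreeLT σ K e d, ∀ j : Fin e, p.coeff j = z j := by
  have hc (j : Fin e) : ((Polynomial.degreeLTEquiv (MvPolynomial σ K) e).symm z).1.coeff j = z j :=
    congrFun ((Polynomial.degreeLTEquiv (MvPolynomial σ K) e).apply_symm_apply z) j
  have hd := Polynomial.mem_degreeLT.1 ((Polynomial.degreeLTEquiv (MvPolynomial σ K) e).symm z).2
  refine ⟨_, ⟨hd, fun j => ?_⟩, hc⟩
  by_cases hj : j < e
  · rw [hc ⟨j, hj⟩]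
    exact hz _
  · rw [Polynomial.coeff_eq_zero_of_degree_lt (hd.trans_le (by exact_mod_cast not_lt.1 hj))]
    exact isHomogeneous_zero _ _ d

/-- A polynomial family of forms is the list of its coefficients. -/
def formsDegreeLTEquiv (σ K : Type*) [Field K] (e d : ℕ) :
    formsDegreeLT σ K e d ≃ₗ[K] (Fin e → homogeneousSubmodule σ K d) :=
  LinearEquiv.ofBijective
    (LinearMap.pi fun j : Fin e => LinearMap.codRestrict (homogeneousSubmodule σ K d)
      (((Polynomial.lcoeff (MvPolynomial σ K) j).restrictScalars K).domRestrict
        (formsDegreeLT σ K e d)) fun p => (mem_formsDegreeLT.1 p.2).2 j) <| by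
    constructor
    · refine (injective_iff_map_eq_zero _).2 ?_
      rintro ⟨p, hp⟩ h
      ext1
      refine Polynomial.ext fun j => ?_
      by_cases hj : j < e
      · exact congrArg Subtype.val (congrFun h ⟨j, hj⟩)
      · exact Polynomial.coeff_eq_zero_of_degree_lt
          (hp.1.trans_le (by exact_mod_cast not_lt.1 hj))
    · intro z
      obtain ⟨p, hp, hz⟩ := exists_coeff_eq (fun j => (z j).2)
      exact ⟨⟨p, hp⟩, funext fun j => Subtype.ext (hz j)⟩

lemma C_mul_mem_formsDegreeLT {f : MvPolynomial σ K} {a d e : ℕ} (hf : f.IsHomogeneous a)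
    {p : Polynomial (MvPolynomial σ K)} (hp : p ∈ formsDegreeLT σ K e d) :
    Polynomial.C f * p ∈ formsDegreeLT σ K e (a + d) := by
  refine ⟨?_, fun j => ?_⟩
  · rw [← Polynomial.smul_eq_C_mul]
    exact (Polynomial.degree_smul_le f p).trans_lt hp.1
  rw [Polynomial.coeff_C_mul]
  exact hf.mul (hp.2 j)

lemma formsDegreeLT_mono {d e e' : ℕ} (h : e ≤ e') :
    formsDegreeLT σ K e d ≤ formsDegreeLT σ K e' d :=
  fun _ hp => ⟨hp.1.trans_le (by exact_mod_cast h), hp.2⟩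

lemma X_mul_mem_formsDegreeLT {d e : ℕ}
    {p : Polynomial (MvPolynomial σ K)} (hp : p ∈ formsDegreeLT σ K e d) :
    Polynomial.X * p ∈ formsDegreeLT σ K (e + 1) d := by
  refine ⟨?_, fun j => ?_⟩
  · rw [Polynomial.degree_lt_iff_coeff_zero] 
    intro j hj
    obtain ⟨j, rfl⟩ := Nat.exists_eq_add_of_le' (Nat.one_le_of_lt hj)
    rw [Polynomial.coeff_X_mul]
    exact Polynomial.coeff_eq_zero_of_degree_lt
      (hp.1.trans_le (by exact_mod_cast Nat.le_of_succ_le_succ hj))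
  · cases j with
    | zero => simpa using isHomogeneous_zero _ _ d
    | succ j => simpa using hp.2 j

/-- McCoy's theorem for a pencil: if `F, G` is regular in the sense that `f ∣ c F, c G` forces
`f ∣ c`, then `F + t G` is a nonzerodivisor modulo `f`. -/
lemma C_dvd_of_dvd_pencil_mul {R : Type*} [CommRing R] {f F G : R}
    (h : ∀ c, f ∣ c * F → f ∣ c * G → f ∣ c) {w : Polynomial R}
    (hw : Polynomial.C f ∣ (Polynomial.C F + Polynomial.X * Polynomial.C G) * w) :
    Polynomial.C f ∣ w := by
  set q := Ideal.Quotient.mk (Ideal.span {f})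
  have hq (x : R) : q x = 0 ↔ f ∣ x := by
    rw [Ideal.Quotient.eq_zero_iff_mem, Ideal.mem_span_singleton]
  have hq' (p : Polynomial R) : p.map q = 0 ↔ Polynomial.C f ∣ p := by
    rw [Polynomial.C_dvd_iff_dvd_coeff, Polynomial.ext_iff]
    simp [hq]
  have hreg : (Polynomial.C F + Polynomial.X * Polynomial.C G).map q ∈
      nonZeroDivisors (Polynomial (R ⧸ Ideal.span {f})) := by
    rw [Polynomial.mem_nonZeroDivisors_iff]
    intro c hc
    obtain ⟨c, rfl⟩ := Ideal.Quotient.mk_surjective c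
    have h0 := congrArg (Polynomial.coeff · 0) hc
    have h1 := congrArg (Polynomial.coeff · 1) hc
    simp at h0 h1
    change q c * q F = 0 at h0
    change q c * q G = 0 at h1
    rw [← map_mul, hq] at h0 h1
    exact (hq c).2 (h c h0 h1)
  rw [← hq', Polynomial.map_mul] at hw
  exact (hq' w).1 (hreg.1 _ hw)

lemma finrank_map_le_of_ker_le {V W U : Type*} [AddCommGroup V] [Module K V] [AddCommGroup W]
    [Module K W] [AddCommGroup U] [Module K U] [FiniteDimensional K U]
    (S : Submodule K V) [FiniteDimensional K S] (g : V →ₗ[K] W) (h : V →ₗ[K] U)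
    (hgh : ∀ x ∈ S, h x = 0 → g x = 0) :
    Module.finrank K (S.map g) ≤ Module.finrank K U := by
  have hle : (h.domRestrict S).ker ≤ (g.domRestrict S).ker := fun x hx => by
    simpa using hgh x.1 x.2 (by simpa using hx)
  have h1 := (h.domRestrict S).finrank_range_add_finrank_ker
  have h2 := (g.domRestrict S).finrank_range_add_finrank_ker
  have h3 := Submodule.finrank_mono hle
  have h4 := (h.domRestrict S).range.finrank_le
  rw [LinearMap.range_domRestrict] at h2
  omega

lemma finrank_add_finrank_map_le {V W : Type*} [AddCommGroup V] [Module K V] [AddCommGroup W]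
    [Module K W] (g : V →ₗ[K] W) {S T : Submodule K V} [FiniteDimensional K T] (h : S ≤ T) :
    Module.finrank K S + Module.finrank K (T.map g) ≤
      Module.finrank K T + Module.finrank K (S.map g) := by
  have : FiniteDimensional K S := Submodule.finiteDimensional_of_le h
  have h1 := (g.domRestrict S).finrank_range_add_finrank_ker
  have h2 := (g.domRestrict T).finrank_range_add_finrank_ker
  rw [LinearMap.range_domRestrict] at h1 h2
  have h3 : Module.finrank K (g.domRestrict S).ker ≤ Module.finrank K (g.domRestrict T).ker := by
    refine LinearMap.finrank_le_finrank_of_injective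
      (f := (Submodule.inclusion h).restrict (p := (g.domRestrict S).ker)
        (q := (g.domRestrict T).ker) fun x hx => by simpa using hx) ?_
    intro x y hxy
    have := congrArg (fun x => x.1.1) hxy
    exact Subtype.ext (Subtype.ext this)
  omega

variable [Fintype σ] [DecidableEq σ]

instance (e d : ℕ) : FiniteDimensional K (formsDegreeLT σ K e d) :=
  (formsDegreeLTEquiv σ K e d).symm.finiteDimensional

lemma finrank_formsDegreeLT (e d : ℕ) :
    Module.finrank K (formsDegreeLT σ K e d) = e * (expDeg σ d).card := by
  rw [(formsDegreeLTEquiv σ K e d).finrank_eq, Module.finrank_pi_fintype]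
  simp [finrank_homogeneousSubmodule]

/-- Dimension count for the family of ideals `(f, F + t G)`: `τ₂` plays the role of the
conditions imposed by fat points, `τ₁` of the part of them seen by a cofactor. -/
lemma finrank_pencil_le {V U : Type*} [AddCommGroup V] [Module K V] [FiniteDimensional K V]
    [AddCommGroup U] [Module K U] [FiniteDimensional K U]
    {f F G : MvPolynomial σ K} {a b : ℕ} (c e : ℕ) (hf : f.IsHomogeneous a)
    (hF : F.IsHomogeneous b) (hG : G.IsHomogeneous b) (hf0 : f ≠ 0) (hF0 : F ≠ 0)
    (hreg : ∀ c, f ∣ c * F → f ∣ c * G → f ∣ c)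
    (τ₂ : MvPolynomial σ K →ₗ[K] V) (τ₁ : MvPolynomial σ K →ₗ[K] U)
    (hsurj : ∀ z, ∃ q : MvPolynomial σ K, q.IsHomogeneous (a + b + c) ∧ τ₂ q = z)
    (hτf : ∀ q, τ₁ q = 0 → τ₂ (f * q) = 0) (hτF : ∀ q, τ₁ q = 0 → τ₂ (F * q) = 0)
    (hτG : ∀ q, τ₁ q = 0 → τ₂ (G * q) = 0) :
    (e + 1) * Module.finrank K V + (e + 1) * (expDeg σ (b + c)).card
        + e * (expDeg σ (a + c)).card ≤
      (e + 1) * (expDeg σ (a + b + c)).card + e * (expDeg σ c).card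
        + (2 * e + 1) * Module.finrank K U := by
  set H := Polynomial.C F + Polynomial.X * Polynomial.C G with hH
  have hH0 : H ≠ 0 := fun h => hF0 <| by
    simpa [hH] using congrArg (Polynomial.coeff · 0) h
  have hfC : Polynomial.C f ≠ 0 := by simpa using hf0
  set A := formsDegreeLT σ K (e + 1) (a + b + c)
  set A₁ := (formsDegreeLT σ K (e + 1) (b + c)).map (LinearMap.mulLeft K (Polynomial.C f))
  set A₂ := (formsDegreeLT σ K e (a + c)).map (LinearMap.mulLeft K H)
  set A₃ := (formsDegreeLT σ K e c).map (LinearMap.mulLeft K (Polynomial.C f * H))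
  set Ψ := mapCoeffs (e + 1) τ₂
  have hinj {h : Polynomial (MvPolynomial σ K)} (h0 : h ≠ 0) (e d : ℕ) :
      Module.finrank K ((formsDegreeLT σ K e d).map (LinearMap.mulLeft K h)) =
        e * (expDeg σ d).card := by
    rw [← finrank_formsDegreeLT (K := K)]
    exact (Submodule.equivMapOfInjective (LinearMap.mulLeft K h) (mul_right_injective₀ h0)
      (formsDegreeLT σ K e d)).finrank_eq.symm
  have hA₁ : A₁ ≤ A := by
    rintro _ ⟨p, hp, rfl⟩
    have := C_mul_mem_formsDegreeLT hf hp
    rwa [← add_assoc] at this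
  have hA₂ : A₂ ≤ A := by
    rintro _ ⟨p, hp, rfl⟩
    have h1 := formsDegreeLT_mono e.le_succ (C_mul_mem_formsDegreeLT hF hp)
    have h2 := X_mul_mem_formsDegreeLT (C_mul_mem_formsDegreeLT hG hp)
    rw [← add_assoc, add_comm b a] at h1 h2
    have := add_mem h1 h2
    rwa [← mul_assoc, ← add_mul] at this
  have hA₃ : A₁ ⊓ A₂ ≤ A₃ := by
    rintro _ ⟨⟨u, hu, rfl⟩, ⟨w, hw, hwu⟩⟩
    simp only [LinearMap.mulLeft_apply] at hwu
    obtain ⟨z, rfl⟩ := C_dvd_of_dvd_pencil_mul hreg ⟨u, hwu⟩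
    refine ⟨z, ⟨?_, fun j => ?_⟩, ?_⟩
    · have := hw.1
      rwa [Polynomial.degree_mul, Polynomial.degree_C hf0, zero_add] at this
    · have := hw.2 j
      rw [Polynomial.coeff_C_mul] at this
      exact isHomogeneous_of_mul_left hf hf0 this
    · simp only [LinearMap.mulLeft_apply]
      rw [← hwu]
      ring
  have hsup : A₁ ⊔ A₂ ≤ A := sup_le hA₁ hA₂
  have d1 := Submodule.finrank_sup_add_finrank_inf_eq A₁ A₂
  have d3 := Submodule.finrank_mono hA₃
  rw [hinj hfC, hinj hH0] at d1
  rw [hinj (mul_ne_zero hfC hH0)] at d3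
  have hΨA : A.map Ψ = ⊤ := by
    rw [eq_top_iff]
    rintro z -
    choose q hq hqz using hsurj
    obtain ⟨p, hp, hpz⟩ := exists_coeff_eq (fun j => hq (z j))
    exact ⟨p, hp, funext fun j => by simp [Ψ, hpz, hqz]⟩
  have d4 := finrank_add_finrank_map_le Ψ hsup
  rw [hΨA, finrank_top, finrank_formsDegreeLT, Module.finrank_pi_fintype] at d4
  simp only [Finset.sum_const, Finset.card_univ, Fintype.card_fin, smul_eq_mul] at d4
  have d7 : Module.finrank K (A₁.map Ψ) ≤ (e + 1) * Module.finrank K U := by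
    have := finrank_map_le_of_ker_le (formsDegreeLT σ K (e + 1) (b + c))
      (Ψ ∘ₗ LinearMap.mulLeft K (Polynomial.C f)) (mapCoeffs (e + 1) τ₁) fun p _ hp => by
        ext j
        simpa [Ψ] using hτf _ (congrFun hp j)
    rw [Submodule.map_comp, Module.finrank_pi_fintype] at this
    simpa using this
  have d8 : Module.finrank K (A₂.map Ψ) ≤ e * Module.finrank K U := by
    have := finrank_map_le_of_ker_le (formsDegreeLT σ K e (a + c))
      (Ψ ∘ₗ LinearMap.mulLeft K H) (mapCoeffs e τ₁) fun p hpm hp => by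
        have hp' (j : ℕ) : τ₁ (p.coeff j) = 0 := by
          by_cases hj : j < e
          · exact congrFun hp ⟨j, hj⟩
          · rw [Polynomial.coeff_eq_zero_of_degree_lt
              (hpm.1.trans_le (by exact_mod_cast not_lt.1 hj)), map_zero]
        ext ⟨j, hj⟩
        cases j with
        | zero => simpa [Ψ, hH, add_mul, mul_assoc] using hτF _ (hp' 0)
        | succ j => simp [Ψ, hH, add_mul, mul_assoc, hτF _ (hp' _), hτG _ (hp' _)]
    rw [Submodule.map_comp, Module.finrank_pi_fintype] at this
    simpa using this
  have d9 := Submodule.finrank_add_le_finrank_add_finrank (A₁.map Ψ) (A₂.map Ψ)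
  rw [← Submodule.map_sup] at d9
  nlinarith

end PolynomialFamilies

section FatPoints

variable {K : Type*} [Field K]

/-- Affine coordinates centred at the point `v`, in the chart where the `c`-th coordinate is
constant. -/
def chart (v : Fin 3 → K) (c : Fin 3) : MvPolynomial (Fin 3) K →ₐ[K] MvPolynomial (Fin 2) K :=
  aeval (c.insertNth (C (v c)) fun j => X j + C (v (c.succAbove j)))

lemma mem_idealOfVars_iff {q : MvPolynomial (Fin 2) K} :
    q ∈ idealOfVars (Fin 2) K ↔ constantCoeff q = 0 := by
  rw [← pow_one (idealOfVars (Fin 2) K), mem_pow_idealOfVars_iff']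
  simp [Finsupp.degree_eq_zero_iff, constantCoeff_eq]

lemma constantCoeff_chart (v : Fin 3 → K) (c : Fin 3) (q : MvPolynomial (Fin 3) K) :
    constantCoeff (chart v c q) = eval v q := by
  induction q using MvPolynomial.induction_on with
  | C r => simp [chart]
  | add p q hp hq => simp [hp, hq]
  | mul_X p i hp =>
    rw [map_mul, map_mul, hp, map_mul, eval_X]
    congr 1
    refine c.succAboveCases ?_ (fun j => ?_) i <;> simp [chart]

/-- The ideal of polynomials vanishing to order `k` at `v`. -/
def fatIdeal (v : Fin 3 → K) (c : Fin 3) (k : ℕ) : Ideal (MvPolynomial (Fin 3) K) :=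
  (idealOfVars (Fin 2) K ^ k).comap (chart v c)

lemma mem_fatIdeal {v : Fin 3 → K} {c : Fin 3} {k : ℕ} {q : MvPolynomial (Fin 3) K} :
    q ∈ fatIdeal v c k ↔ chart v c q ∈ idealOfVars (Fin 2) K ^ k := Iff.rfl

lemma pow_mem_fatIdeal {v : Fin 3 → K} {c : Fin 3} {q : MvPolynomial (Fin 3) K}
    (hq : eval v q = 0) (k : ℕ) : q ^ k ∈ fatIdeal v c k := by
  rw [mem_fatIdeal, map_pow]
  exact Ideal.pow_mem_pow (mem_idealOfVars_iff.2 (by rwa [constantCoeff_chart])) k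

lemma pointIdeal_pow_le_fatIdeal (q : ℙ K (Fin (2 + 1) → K)) (c : Fin 3) (m : ℕ) :
    pointIdeal q ^ m ≤ fatIdeal q.rep c m := by
  refine (Ideal.pow_right_mono (Ideal.span_le.2 ?_) m).trans (Ideal.le_comap_pow (chart q.rep c) m)
  rintro f ⟨-, hf⟩
  exact mem_idealOfVars_iff.2 ((constantCoeff_chart _ _ _).trans hf)

lemma exists_isHomogeneous_chart_sub_mem {v : Fin 3 → K} {c : Fin 3} (hc : v c ≠ 0) {k d : ℕ}
    (hd : k ≤ d) (y : MvPolynomial (Fin 2) K) :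
    ∃ q : MvPolynomial (Fin 3) K, q.IsHomogeneous d ∧
      chart v c q - y ∈ idealOfVars (Fin 2) K ^ k := by
  induction y using MvPolynomial.induction_on' with
  | monomial x r =>
    by_cases hx : x.degree < k
    · let l (j : Fin 2) : MvPolynomial (Fin 3) K :=
        X (c.succAbove j) - C (v (c.succAbove j) / v c) * X c
      have hl (j : Fin 2) : (l j).IsHomogeneous 1 :=
        (isHomogeneous_X _ _).sub (isHomogeneous_C_mul_X _ _)
      have hcl (j : Fin 2) : chart v c (l j) = X j := by
        simp [l, chart, ← C_mul, div_mul_cancel₀ _ hc]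
      have hc0 : chart v c (C (v c)⁻¹ * X c) = 1 := by
        simp [chart, ← C_mul, inv_mul_cancel₀ hc]
      refine ⟨C r * ((C (v c)⁻¹ * X c) ^ (d - x.degree) * ∏ j, l j ^ x j), ?_, ?_⟩
      · have h1 := (isHomogeneous_C_mul_X (v c)⁻¹ c).pow (d - x.degree)
        have h2 := IsHomogeneous.prod Finset.univ (fun j => l j ^ x j) (fun j => 1 * x j)
          fun j _ => (hl j).pow (x j)
        have h3 := (h1.mul h2).C_mul r
        convert h3 using 1
        simp only [one_mul, ← Finsupp.degree_eq_sum]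
        omega
      · have : chart v c (C r * ((C (v c)⁻¹ * X c) ^ (d - x.degree) * ∏ j, l j ^ x j)) =
            monomial x r := by
          rw [map_mul, map_mul, map_pow, hc0, map_prod]
          simp only [map_pow, hcl, one_pow, one_mul]
          rw [monomial_eq, Finsupp.prod_fintype _ _ (by simp)]
          simp [chart]
        rw [this, sub_self]
        exact zero_mem _
    · refine ⟨0, isHomogeneous_zero _ _ d, ?_⟩
      rw [map_zero, zero_sub, neg_mem_iff, mem_pow_idealOfVars_iff']
      intro z hz
      rw [coeff_monomial, if_neg]
      rintro rfl
      exact hx hz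
  | add p q hp hq =>
    obtain ⟨p', hp, hp'⟩ := hp
    obtain ⟨q', hq, hq'⟩ := hq
    refine ⟨p' + q', hp.add hq, ?_⟩
    rw [map_add, add_sub_add_comm]
    exact add_mem hp' hq'

lemma exists_mul_sub_mem {u : MvPolynomial (Fin 2) K} (hu : constantCoeff u ≠ 0) (k : ℕ)
    (y : MvPolynomial (Fin 2) K) : ∃ w, u * w - y ∈ idealOfVars (Fin 2) K ^ k := by
  have h1 : IsCoprime (Ideal.span {u}) (idealOfVars (Fin 2) K) := by
    rw [Ideal.isCoprime_iff_exists]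
    refine ⟨u * C (constantCoeff u)⁻¹, Ideal.mul_mem_right _ _ (Ideal.mem_span_singleton_self u),
      1 - u * C (constantCoeff u)⁻¹, ?_, by ring⟩
    simp [mem_idealOfVars_iff, hu]
  obtain ⟨s, hs, t, ht, hst⟩ := Ideal.isCoprime_iff_exists.1 (h1.pow_right (n := k))
  obtain ⟨w, rfl⟩ := Ideal.mem_span_singleton.1 hs
  refine ⟨w * y, ?_⟩
  have : u * (w * y) - y = -(t * y) := by
    linear_combination y * hst
  rw [this, neg_mem_iff]
  exact Ideal.mul_mem_right _ _ ht

/-- The linear conditions imposed by points of multiplicity `k`. -/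
def fatConditions {n : ℕ} (v : Fin n → Fin 3 → K) (c : Fin n → Fin 3) (k : ℕ) :
    MvPolynomial (Fin 3) K →ₗ[K] (Fin n → expLT (Fin 2) k → K) :=
  LinearMap.pi fun i => coeffsOn (expLT (Fin 2) k) ∘ₗ (chart (v i) (c i)).toLinearMap

lemma fatConditions_apply_eq_zero_iff {n : ℕ} {v : Fin n → Fin 3 → K} {c : Fin n → Fin 3} {k : ℕ}
    {q : MvPolynomial (Fin 3) K} {i : Fin n} :
    fatConditions v c k q i = 0 ↔ q ∈ fatIdeal (v i) (c i) k :=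
  coeffsOn_expLT_eq_zero_iff

lemma finrank_fatConditions (n k : ℕ) :
    Module.finrank K (Fin n → expLT (Fin 2) k → K) = n * (expLT (Fin 2) k).card := by
  simp [Module.finrank_pi_fintype]

lemma fatConditions_mul_eq_zero {n m l : ℕ} {v : Fin n → Fin 3 → K} {c : Fin n → Fin 3}
    {f q : MvPolynomial (Fin 3) K} (hf : ∀ i, f ∈ fatIdeal (v i) (c i) m)
    (hq : fatConditions v c l q = 0) : fatConditions v c (m + l) (f * q) = 0 := by
  funext i
  refine fatConditions_apply_eq_zero_iff.2 ?_
  rw [mem_fatIdeal, map_mul, pow_add]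
  exact Ideal.mul_mem_mul (hf i) (fatConditions_apply_eq_zero_iff.1 (congrFun hq i))

lemma exists_fatConditions_eq {n : ℕ} {v : Fin n → Fin 3 → K} {c : Fin n → Fin 3}
    (hc : ∀ i, v i (c i) ≠ 0)
    (hsep : ∀ i j, i ≠ j → ∃ l : MvPolynomial (Fin 3) K, l.IsHomogeneous 1 ∧
      eval (v j) l = 0 ∧ eval (v i) l ≠ 0) {k d : ℕ} (hd : n * k ≤ d)
    (z : Fin n → expLT (Fin 2) k → K) :
    ∃ q : MvPolynomial (Fin 3) K, q.IsHomogeneous d ∧ fatConditions v c k q = z := by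
  choose! l hl using hsep
  have key (i : Fin n) : ∃ q : MvPolynomial (Fin 3) K, q.IsHomogeneous d ∧
      fatConditions v c k q = Pi.single i (z i) := by
    let g := ∏ j ∈ Finset.univ.erase i, l i j ^ k
    have hg : g.IsHomogeneous ((n - 1) * k) := by
      have := IsHomogeneous.prod (Finset.univ.erase i) (fun j => l i j ^ k) (fun _ => 1 * k)
        fun j hj => ((hl i j (Finset.ne_of_mem_erase hj).symm).1.pow k)
      simpa [Finset.card_erase_of_mem] using this
    have hgi : constantCoeff (chart (v i) (c i) g) ≠ 0 := by
      rw [constantCoeff_chart, map_prod]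
      refine Finset.prod_ne_zero_iff.2 fun j hj => ?_
      rw [map_pow]
      exact pow_ne_zero _ (hl i j (Finset.ne_of_mem_erase hj).symm).2.2
    have hgj (j : Fin n) (hj : j ≠ i) : g ∈ fatIdeal (v j) (c j) k :=
      Ideal.mem_of_dvd _ (Finset.dvd_prod_of_mem (fun j => l i j ^ k) (by simp [hj]))
        (pow_mem_fatIdeal (hl i j hj.symm).2.1 k)
    have hn : (n - 1) * k + k = n * k := by
      obtain ⟨n, rfl⟩ := Nat.exists_eq_succ_of_ne_zero i.pos.ne'
      simp [Nat.succ_mul]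
    obtain ⟨y, -, hy⟩ := exists_coeffsOn_eq (expLT (Fin 2) k) (z i)
    obtain ⟨w, hw⟩ := exists_mul_sub_mem hgi k y
    obtain ⟨q, hq, hqw⟩ := exists_isHomogeneous_chart_sub_mem (hc i)
      (show k ≤ d - (n - 1) * k by omega) w
    refine ⟨g * q, ?_, ?_⟩
    · have := hg.mul hq
      rwa [Nat.add_sub_cancel' (by omega)] at this
    · funext j
      by_cases hj : j = i
      · subst hj
        rw [Pi.single_eq_same, ← hy, ← sub_eq_zero]
        change coeffsOn _ (chart (v j) (c j) (g * q)) - _ = 0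
        rw [← map_sub, coeffsOn_expLT_eq_zero_iff, map_mul]
        convert add_mem (Ideal.mul_mem_left _ (chart (v j) (c j) g) hqw) hw using 1
        ring
      · rw [Pi.single_eq_of_ne hj, fatConditions_apply_eq_zero_iff]
        exact Ideal.mul_mem_right _ _ (hgj j hj)
  choose q hq hqz using key
  refine ⟨∑ i, q i, IsHomogeneous.sum _ _ _ fun i _ => hq i, ?_⟩
  rw [map_sum, Finset.sum_congr rfl fun i _ => hqz i]
  exact Finset.univ_sum_single z

/-- Bézout's inequality for curves with assigned multiplicities, the second curve being a
generic member of the pencil spanned by `F` and `G`. -/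
lemma card_mul_sq_le_mul_of_pencil {n m a b : ℕ} {v : Fin n → Fin 3 → K} {c : Fin n → Fin 3}
    (hc : ∀ i, v i (c i) ≠ 0)
    (hsep : ∀ i j, i ≠ j → ∃ l : MvPolynomial (Fin 3) K, l.IsHomogeneous 1 ∧
      eval (v j) l = 0 ∧ eval (v i) l ≠ 0)
    {f F G : MvPolynomial (Fin 3) K} (hf : f.IsHomogeneous a)
    (hF : F.IsHomogeneous b) (hG : G.IsHomogeneous b) (hf0 : f ≠ 0) (hF0 : F ≠ 0)
    (hreg : ∀ c, f ∣ c * F → f ∣ c * G → f ∣ c)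
    (hfm : ∀ i, f ∈ fatIdeal (v i) (c i) m) (hFm : ∀ i, F ∈ fatIdeal (v i) (c i) m)
    (hGm : ∀ i, G ∈ fatIdeal (v i) (c i) m) : n * m ^ 2 ≤ a * b := by
  obtain ⟨d, hd⟩ : ∃ d, d = n * (m + m) := ⟨_, rfl⟩
  obtain ⟨e, he⟩ : ∃ e, e = (expDeg (Fin 3) (a + d)).card := ⟨_, rfl⟩
  have h := finrank_pencil_le d e hf hF hG hf0 hF0 hreg (fatConditions v c (m + m))
    (fatConditions v c m) (fun z => exists_fatConditions_eq hc hsep (by omega) z)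
    (fun q => fatConditions_mul_eq_zero hfm) (fun q => fatConditions_mul_eq_zero hFm)
    (fun q => fatConditions_mul_eq_zero hGm)
  rw [finrank_fatConditions, finrank_fatConditions] at h
  have h' : ((e + 1) * (n * m ^ 2) : ℚ) ≤ (e + 1) * (a * b) + e := by
    have hq := (Nat.cast_le (α := ℚ)).2 h
    push_cast at hq
    have hx := card_expDeg_three (a + d)
    rw [← he] at hq hx
    simp only [card_expLT_two, card_expDeg_three] at hq
    have hy : (0 : ℚ) ≤ (d + 1) * (d + 2) / 2 := by positivity
    have hz : (0 : ℚ) ≤ n * (m * (m + 1) / 2) := by positivity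
    push_cast at hq hx
    linear_combination hq + hy + hz - (e + 1) * hx
  have h'' : (e + 1) * (n * m ^ 2) ≤ (e + 1) * (a * b) + e := by exact_mod_cast h'
  by_contra! hlt
  nlinarith

end FatPoints

section Points

variable {K : Type*} [Field K]

lemma exists_linear_form_separating {p q : ℙ K (Fin (2 + 1) → K)} (h : p ≠ q) :
    ∃ l : MvPolynomial (Fin 3) K, l.IsHomogeneous 1 ∧ eval q.rep l = 0 ∧ eval p.rep l ≠ 0 := by
  by_contra! hl
  obtain ⟨c, hc⟩ := Function.ne_iff.1 q.rep_nonzero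
  refine h ?_
  rw [← p.mk_rep, ← q.mk_rep, Projectivization.mk_eq_mk_iff']
  refine ⟨p.rep c / q.rep c, funext fun j => ?_⟩
  have := hl (C (q.rep c) * X j - C (q.rep j) * X c)
    ((isHomogeneous_C_mul_X _ _).sub (isHomogeneous_C_mul_X _ _)) (by simp [mul_comm])
  simp only [map_sub, map_mul, eval_C, eval_X] at this
  simp only [Pi.zero_apply] at hc
  simp only [Pi.smul_apply, smul_eq_mul]
  field_simp
  linear_combination -this

lemma mul_succ_le_of_le_alphaDeg {n : ℕ} (p : Fin n → ℙ K (Fin (2 + 1) → K)) :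
    alphaDeg (⨅ i, pointIdeal (p i)) * (alphaDeg (⨅ i, pointIdeal (p i)) + 1) ≤ 2 * n := by
  obtain h0 | ha := Nat.eq_zero_or_eq_succ_pred (alphaDeg (⨅ i, pointIdeal (p i)))
  · simp [h0]
  set a := (alphaDeg (⨅ i, pointIdeal (p i))).pred
  let ev : homogeneousSubmodule (Fin 3) K a →ₗ[K] (Fin n → K) :=
    LinearMap.pi fun i => (aeval (p i).rep).toLinearMap.domRestrict _
  have hinj : Function.Injective ev := by
    refine (injective_iff_map_eq_zero _).2 ?_
    rintro ⟨f, hf⟩ hfe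
    by_contra hne
    have : alphaDeg (⨅ i, pointIdeal (p i)) ≤ a := Nat.sInf_le ⟨f, ?_, ?_, hf⟩
    · omega
    · refine (Submodule.mem_iInf _).2 fun i => Ideal.subset_span ⟨⟨a, hf⟩, ?_⟩
      simpa [ev, aeval_eq_eval] using congrFun hfe i
    · rintro rfl
      exact hne rfl
  have h := LinearMap.finrank_le_finrank_of_injective hinj
  rw [finrank_homogeneousSubmodule, Module.finrank_fin_fun] at h
  have hq := (Nat.cast_le (α := ℚ)).2 h
  rw [card_expDeg_three] at hq
  rw [ha]
  have : (((a + 1) * (a + 1 + 1) : ℕ) : ℚ) ≤ (2 * n : ℕ) := by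
    push_cast
    linarith
  exact_mod_cast this

lemma dvd_of_isRegular_pair {R : Type*} [CommRing R] [IsDomain R] {F G : R}
    (h : RingTheory.Sequence.IsRegular R [F, G]) :
    F ≠ 0 ∧ ∀ f c, f ∣ c * F → f ∣ c * G → f ∣ c := by
  have hw := (RingTheory.Sequence.isWeaklyRegular_cons_iff R F [G]).1 h.toIsWeaklyRegular
  have hF : F ≠ 0 := by
    rintro rfl
    exact one_ne_zero (hw.1 (by simp : (0 : R) • (1 : R) = (0 : R) • (0 : R)))
  refine ⟨hF, fun f c ⟨u, hu⟩ ⟨w, hw'⟩ => ?_⟩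
  have hG := (RingTheory.Sequence.isWeaklyRegular_singleton_iff _ _).1 hw.2
  have hdvd (x : R) (hx : F ∣ G * x) : F ∣ x := by
    have hmem (y : R) : (Submodule.Quotient.mk y : QuotSMulTop F R) = 0 ↔ F ∣ y := by
      rw [Submodule.Quotient.mk_eq_zero, Submodule.mem_smul_pointwise_iff_exists]
      simp [dvd_def, eq_comm]
    rw [← hmem]
    refine hG ?_
    simp only [smul_zero]
    exact (hmem (G * x)).2 hx
  by_cases hf : f = 0
  · subst hf
    simp [hF] at hu
    simp [hu]
  have : G * u = F * w := mul_left_cancel₀ hf (by linear_combination F * hw' - G * hu)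
  obtain ⟨t, rfl⟩ := hdvd u ⟨w, this⟩
  exact ⟨t, mul_right_cancel₀ hF (by linear_combination hu)⟩

end Points

/-- for the radical ideal `I` of `n` distinct points of `ℙ²`,
`α(I^(m))/m ≥ ((α(I)+1)/2)·(m·α(I)/β(I^(m)))` for every `m ≥ 1`. -/
theorem stmt7 {K : Type*} [Field K] {n : ℕ} (hn : 0 < n)
    (p : Fin n → ℙ K (Fin (2 + 1) → K)) (hinj : Function.Injective p) :
    ∀ m : ℕ, 1 ≤ m →
      (alphaDeg (⨅ i, (pointIdeal (p i)) ^ m) : ℚ) / m ≥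
        (((alphaDeg (⨅ i, pointIdeal (p i)) : ℚ) + 1) / 2) *
          ((m * (alphaDeg (⨅ i, pointIdeal (p i)) : ℚ)) /
            (betaDeg (⨅ i, (pointIdeal (p i)) ^ m) : ℚ)) := by
  intro m hm
  have hα := mul_succ_le_of_le_alphaDeg p
  set α := alphaDeg (⨅ i, pointIdeal (p i))
  set J := ⨅ i, (pointIdeal (p i)) ^ m
  obtain hβ | hβ := Nat.eq_zero_or_pos (betaDeg J)
  · rw [hβ]
    simp only [Nat.cast_zero, div_zero, mul_zero]
    positivity
  obtain ⟨F, G, hFJ, hGJ, hF, hG, hreg⟩ := Nat.sInf_mem (Nat.nonempty_of_pos_sInf hβ)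
  change F.IsHomogeneous (betaDeg J) at hF
  change G.IsHomogeneous (betaDeg J) at hG
  obtain ⟨hF0, hdvd⟩ := dvd_of_isRegular_pair hreg
  obtain ⟨f, hfJ, hf0, hf⟩ :=
    Nat.sInf_mem (s := {d : ℕ | ∃ f ∈ J, f ≠ 0 ∧ f.IsHomogeneous d}) ⟨_, F, hFJ, hF0, hF⟩
  change f.IsHomogeneous (alphaDeg J) at hf
  choose c hc using fun i => Function.ne_iff.1 (p i).rep_nonzero
  have hmem (q : MvPolynomial (Fin 3) K) (hq : q ∈ J) (i : Fin n) :
      q ∈ fatIdeal (p i).rep (c i) m :=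
    pointIdeal_pow_le_fatIdeal _ _ _ ((Submodule.mem_iInf _).1 hq i)
  have hB : n * m ^ 2 ≤ alphaDeg J * betaDeg J :=
    card_mul_sq_le_mul_of_pencil hc
      (fun i j hij => exists_linear_form_separating (hinj.ne hij)) hf hF hG hf0 hF0 (hdvd f)
      (hmem f hfJ) (hmem F hFJ) (hmem G hGJ)
  have hm' : (0 : ℚ) < m := by exact_mod_cast hm
  have hβ' : (0 : ℚ) < betaDeg J := by exact_mod_cast hβ
  have hα' : (α * (α + 1) : ℚ) ≤ 2 * n := by exact_mod_cast hα
  have hB' : (n * m ^ 2 : ℚ) ≤ alphaDeg J * betaDeg J := by exact_mod_cast hB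
  rw [ge_iff_le, div_mul_div_comm, div_le_div_iff₀ (by positivity) hm']
  nlinarith [mul_le_mul_of_nonneg_right hα' (sq_nonneg (m : ℚ))]

end
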